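/- arXiv:2001.08006 — 2 statements merged into one kernel-verified Lean document; each statement's English description precedes it below -/
import Mathlib

section
/- Let X, Y be closed subsets of ℝ^D, let r₁, r₂, t > 0 with r₁ ≤ r₂, let ε > 0, and let p ∈ X ∩ Y. If the Hausdorff distance satisfies H(X ∩ closedBall(p, r₂), Y ∩ closedBall(p, r₂)) ≤ ε, then h^loc_X(p, r₁, r₂; t) ≤ h^loc_Y(p, r₁ + ε, r₂; t + ε) + 2ε. -/
/-- The radius of a smallest enclosing closed ball of `σ`. -/
noncomputable def rad {E : Type*} [NormedAddCommGroup E] (σ : Set E) : ℝ :=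
  sInf {r : ℝ | 0 ≤ r ∧ ∃ c : E, σ ⊆ Metric.closedBall c r}

/-- Asymmetric Hausdorff distance `H(A | B) = sup_{a ∈ A} dist (a, B)`. -/
noncomputable def asymmHaus {E : Type*} [NormedAddCommGroup E] (A B : Set E) : ℝ :=
  sSup ((fun a => Metric.infDist a B) '' A)

/-- The convex hull of `X` at scale `t`. -/
def scaleHull {E : Type*} [NormedAddCommGroup E] [NormedSpace ℝ E]
    (X : Set E) (t : ℝ) : Set E :=
  ⋃ (σ : Set E) (_ : σ ⊆ X ∧ rad σ ≤ t), convexHull ℝ σ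

/-- The convexity defect function `h_X(t)`. -/
noncomputable def cdf {E : Type*} [NormedAddCommGroup E] [NormedSpace ℝ E]
    (X : Set E) (t : ℝ) : ℝ :=
  asymmHaus (scaleHull X t) X

/-- The local convexity defect function `h^loc_X(p, r₁, r₂; t)`. -/
noncomputable def cdfLoc {E : Type*} [NormedAddCommGroup E] [NormedSpace ℝ E]
    (X : Set E) (p : E) (r₁ r₂ t : ℝ) : ℝ :=
  asymmHaus
    (⋃ (σ : Set E) (_ : σ ⊆ X ∩ Metric.closedBall p r₁ ∧ rad σ ≤ t), convexHull ℝ σ)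
    (X ∩ Metric.closedBall p r₂)

open Metric
open scoped Pointwise

theorem rad_le_of_subset_closedBall {E : Type*} [NormedAddCommGroup E] {σ : Set E} {c : E} {r : ℝ}
    (hr : 0 ≤ r) (h : σ ⊆ closedBall c r) : rad σ ≤ r :=
  csInf_le ⟨0, fun _ hx => hx.1⟩ ⟨hr, c, h⟩

theorem rad_le_rad_add {E : Type*} [NormedAddCommGroup E] {σ τ : Set E} {ε : ℝ} (hε : 0 ≤ ε)
    (hσ : Bornology.IsBounded σ) (h : ∀ y ∈ τ, ∃ x ∈ σ, dist x y ≤ ε) :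
    rad τ ≤ rad σ + ε := by
  refine le_of_forall_pos_le_add fun δ hδ => ?_
  have hne : {r : ℝ | 0 ≤ r ∧ ∃ c : E, σ ⊆ closedBall c r}.Nonempty := by
    obtain ⟨r, hr⟩ := hσ.subset_closedBall 0
    exact ⟨max r 0, le_max_right _ _, 0, hr.trans (closedBall_subset_closedBall (le_max_left _ _))⟩
  obtain ⟨r, ⟨hr, c, hc⟩, hlt⟩ := exists_lt_of_csInf_lt hne
    (show sInf {r : ℝ | 0 ≤ r ∧ ∃ c : E, σ ⊆ closedBall c r} < rad σ + δ from
      lt_add_of_pos_right _ hδ)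
  have hτ : τ ⊆ closedBall c (r + ε) := by
    intro y hy
    obtain ⟨x, hx, hxy⟩ := h y hy
    have hxc := mem_closedBall.1 (hc hx)
    have := dist_triangle_left y c x
    exact mem_closedBall.2 (by linarith)
  linarith [rad_le_of_subset_closedBall (add_nonneg hr hε) hτ]

theorem exists_mem_convexHull_dist_le {E : Type*} [NormedAddCommGroup E] [NormedSpace ℝ E]
    {σ τ : Set E} {ε : ℝ} (h : ∀ x ∈ σ, ∃ y ∈ τ, dist x y ≤ ε) {a : E}
    (ha : a ∈ convexHull ℝ σ) : ∃ b ∈ convexHull ℝ τ, dist a b ≤ ε := by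
  have hconv : Convex ℝ (convexHull ℝ τ + closedBall (0 : E) ε) :=
    (convex_convexHull ℝ τ).add (convex_closedBall 0 ε)
  have hsub : σ ⊆ convexHull ℝ τ + closedBall (0 : E) ε := by
    intro x hx
    obtain ⟨y, hy, hxy⟩ := h x hx
    exact Set.mem_add.2 ⟨y, subset_convexHull ℝ τ hy, x - y,
      by rwa [mem_closedBall_zero_iff, ← dist_eq_norm], by abel⟩
  obtain ⟨b, hb, v, hv, rfl⟩ := Set.mem_add.1 (convexHull_min hsub hconv ha)
  exact ⟨b, hb, by simpa using hv⟩

theorem asymmHaus_nonneg {E : Type*} [NormedAddCommGroup E] (A B : Set E) : 0 ≤ asymmHaus A B :=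
  Real.sSup_nonneg (by rintro _ ⟨a, _, rfl⟩; exact infDist_nonneg)

theorem infDist_le_asymmHaus {E : Type*} [NormedAddCommGroup E] {A B : Set E}
    (hA : Bornology.IsBounded A) (hB : B.Nonempty) {a : E} (ha : a ∈ A) :
    infDist a B ≤ asymmHaus A B := by
  obtain ⟨b, hb⟩ := hB
  obtain ⟨r, hr⟩ := hA.subset_closedBall b
  refine le_csSup ⟨r, ?_⟩ ⟨a, ha, rfl⟩
  rintro _ ⟨x, hx, rfl⟩
  exact (infDist_le_dist_of_mem hb).trans (hr hx)

theorem infDist_le_cdfLoc {E : Type*} [NormedAddCommGroup E] [NormedSpace ℝ E]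
    {X σ : Set E} {p b : E} {r₁ r₂ t : ℝ} (hne : (X ∩ closedBall p r₂).Nonempty)
    (hσ : σ ⊆ X ∩ closedBall p r₁) (hrad : rad σ ≤ t) (hb : b ∈ convexHull ℝ σ) :
    infDist b (X ∩ closedBall p r₂) ≤ cdfLoc X p r₁ r₂ t := by
  refine infDist_le_asymmHaus ((isBounded_closedBall (x := p) (r := r₁)).subset (Set.iUnion₂_subset fun ρ hρ => ?_)) hne
    (Set.mem_iUnion₂.2 ⟨σ, ⟨hσ, hrad⟩, hb⟩)
  exact convexHull_min (hρ.1.trans Set.inter_subset_right) (convex_closedBall p r₁)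

/-- Hausdorff stability of the local convexity defect function. -/
theorem cdfLoc_stability {D : ℕ} (X Y : Set (EuclideanSpace ℝ (Fin D)))
    (hX : IsClosed X) (hY : IsClosed Y)
    (r₁ r₂ t ε : ℝ) (hr₁ : 0 < r₁) (hr₂ : 0 < r₂) (ht : 0 < t) (hε : 0 < ε)
    (hr₁₂ : r₁ ≤ r₂)
    (p : EuclideanSpace ℝ (Fin D)) (hp : p ∈ X ∩ Y)
    (hH : Metric.hausdorffDist (X ∩ Metric.closedBall p r₂)
            (Y ∩ Metric.closedBall p r₂) ≤ ε) :
    cdfLoc X p r₁ r₂ t ≤ cdfLoc Y p (r₁ + ε) r₂ (t + ε) + 2 * ε := by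
  have hneX : (X ∩ closedBall p r₂).Nonempty := ⟨p, hp.1, mem_closedBall_self hr₂.le⟩
  have hneY : (Y ∩ closedBall p r₂).Nonempty := ⟨p, hp.2, mem_closedBall_self hr₂.le⟩
  have hfin : hausdorffEDist (X ∩ closedBall p r₂) (Y ∩ closedBall p r₂) ≠ ⊤ :=
    hausdorffEDist_ne_top_of_nonempty_of_bounded hneX hneY
      (isBounded_closedBall.subset Set.inter_subset_right)
      (isBounded_closedBall.subset Set.inter_subset_right)
  have hcomp : IsCompact (Y ∩ closedBall p r₂) := (isCompact_closedBall p r₂).inter_left hY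
  refine Real.sSup_le ?_ (add_nonneg (asymmHaus_nonneg _ _) (by positivity))
  rintro _ ⟨a, ha, rfl⟩
  obtain ⟨σ, ⟨hσ, hrad⟩, ha⟩ := Set.mem_iUnion₂.1 ha
  set τ := {y ∈ Y ∩ closedBall p r₂ | ∃ x ∈ σ, dist x y ≤ ε}
  have hστ : ∀ x ∈ σ, ∃ y ∈ τ, dist x y ≤ ε := by
    intro x hx
    have hxX : x ∈ X ∩ closedBall p r₂ :=
      ⟨(hσ hx).1, closedBall_subset_closedBall hr₁₂ (hσ hx).2⟩
    obtain ⟨y, hy, hxy⟩ := hcomp.exists_infDist_eq_dist hneY x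
    have hle : dist x y ≤ ε := hxy ▸ (infDist_le_hausdorffDist_of_mem hxX hfin).trans hH
    exact ⟨y, ⟨hy, x, hx, hle⟩, hle⟩
  have hτ : τ ⊆ Y ∩ closedBall p (r₁ + ε) := by
    rintro y ⟨hy, x, hx, hxy⟩
    have hxp := mem_closedBall.1 (hσ hx).2
    have := dist_triangle_left y p x
    exact ⟨hy.1, mem_closedBall.2 (by linarith)⟩
  have hradτ : rad τ ≤ t + ε :=
    (rad_le_rad_add hε.le (isBounded_closedBall.subset (hσ.trans Set.inter_subset_right))
      fun y hy => hy.2).trans (by linarith)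
  obtain ⟨b, hb, hab⟩ := exists_mem_convexHull_dist_le hστ ha
  have hbY := infDist_le_cdfLoc hneY hτ hradτ hb
  have haX := infDist_le_infDist_add_dist (s := X ∩ closedBall p r₂) (x := a) (y := b)
  rw [hausdorffEDist_comm] at hfin
  rw [hausdorffDist_comm] at hH
  have hbX := infDist_le_infDist_add_hausdorffDist (x := b) hfin
  change infDist a (X ∩ closedBall p r₂) ≤ _
  linarith
end

section
/- Let M and M̃ be nonempty compact subsets of ℝ^D with Hausdorff distance H(M, M̃) < ε, where 0 < ε < Δ < 1. Suppose there are constants κ ≥ 0 and C' ≥ 0 such that |h_M(t) − (κ/2) t²| ≤ C' t³ for all t ∈ [0, Δ + ε]. Then |κ − 2 h_{M̃}(Δ)/Δ²| ≤ 2C' Δ + (3κ + 14C' + 4) ε Δ^{−2}. In particular, if in addition Δ = ε^{1/3}, then |κ − 2 h_{M̃}(Δ)/Δ²| ≤ (3κ + 16C' + 4) ε^{1/3}. -/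
section HausdorffStability

variable {E : Type*} [NormedAddCommGroup E]

theorem rad_le {σ : Set E} {r : ℝ} (hr : 0 ≤ r) {c : E} (h : σ ⊆ Metric.closedBall c r) :
    rad σ ≤ r :=
  csInf_le ⟨0, fun _ hx => hx.1⟩ ⟨hr, c, h⟩

theorem rad_le_add_of_forall_exists_dist_le {σ τ : Set E} (hσ : Bornology.IsBounded σ) {ε : ℝ}
    (hε : 0 ≤ ε) (h : ∀ y ∈ τ, ∃ x ∈ σ, dist x y ≤ ε) : rad τ ≤ rad σ + ε := by
  rw [← sub_le_iff_le_add]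
  refine le_csInf ?_ ?_
  · obtain ⟨r, hr⟩ := hσ.subset_closedBall 0
    exact ⟨max r 0, le_max_right _ _, 0,
      hr.trans (Metric.closedBall_subset_closedBall (le_max_left _ _))⟩
  · rintro r ⟨hr, c, hc⟩
    rw [sub_le_iff_le_add]
    refine rad_le (add_nonneg hr hε) (c := c) fun y hy => ?_
    obtain ⟨x, hx, hxy⟩ := h y hy
    have hxc : dist x c ≤ r := hc hx
    rw [Metric.mem_closedBall]
    linarith [dist_triangle_left y c x]

variable [NormedSpace ℝ E]

theorem scaleHull_subset_convexHull (X : Set E) (t : ℝ) : scaleHull X t ⊆ convexHull ℝ X :=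
  Set.iUnion₂_subset fun _ hσ => convexHull_mono hσ.1

theorem cdf_nonneg (X : Set E) (t : ℝ) : 0 ≤ cdf X t :=
  Real.sSup_nonneg (by rintro _ ⟨x, -, rfl⟩; exact Metric.infDist_nonneg)

theorem infDist_le_cdf {X : Set E} (hX : Bornology.IsBounded X) (hne : X.Nonempty) {t : ℝ} {y : E}
    (hy : y ∈ scaleHull X t) : Metric.infDist y X ≤ cdf X t := by
  refine le_csSup ?_ ⟨y, hy, rfl⟩
  obtain ⟨p, hp⟩ := hne
  obtain ⟨r, hr⟩ := (isBounded_convexHull.2 hX).subset_closedBall p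
  refine ⟨r, ?_⟩
  rintro _ ⟨x, hx, rfl⟩
  exact (Metric.infDist_le_dist_of_mem hp).trans (hr (scaleHull_subset_convexHull X t hx))

/-- Stability of the convexity defect function under perturbations in the Hausdorff distance. -/
theorem cdf_le_cdf_add {X Y : Set E} (hX : Bornology.IsBounded X) (hXne : X.Nonempty)
    (hY : Bornology.IsBounded Y) (hYne : Y.Nonempty) {ε : ℝ} (hε : 0 < ε)
    (hH : Metric.hausdorffDist X Y < ε) (t : ℝ) : cdf X t ≤ cdf Y (t + ε) + 2 * ε := by
  have hfin : Metric.hausdorffEDist X Y ≠ ⊤ :=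
    Metric.hausdorffEDist_ne_top_of_nonempty_of_bounded hXne hYne hX hY
  refine Real.sSup_le ?_ (by linarith [cdf_nonneg Y (t + ε)])
  rintro _ ⟨x, hx, rfl⟩
  obtain ⟨σ, ⟨hσX, hσt⟩, hxσ⟩ := Set.mem_iUnion₂.1 hx
  let τ : Set E := {y ∈ Y | ∃ x ∈ σ, dist x y ≤ ε}
  have hτ : rad τ ≤ t + ε :=
    (rad_le_add_of_forall_exists_dist_le (hX.subset hσX) hε.le fun y hy => hy.2).trans
      (by linarith)
  have hsub : convexHull ℝ σ ⊆ Metric.thickening ε (convexHull ℝ τ) := by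
    refine convexHull_min (fun z hz => ?_) ((convex_convexHull ℝ τ).thickening ε)
    obtain ⟨y, hy, hzy⟩ := Metric.exists_dist_lt_of_hausdorffDist_lt (hσX hz) hH hfin
    exact Metric.mem_thickening_iff.2 ⟨y, subset_convexHull ℝ τ ⟨hy, z, hz, hzy.le⟩, hzy⟩
  obtain ⟨y, hy, hxy⟩ := Metric.mem_thickening_iff.1 (hsub hxσ)
  have hyY : Metric.infDist y Y ≤ cdf Y (t + ε) :=
    infDist_le_cdf hY hYne (Set.mem_iUnion₂.2 ⟨τ, ⟨fun _ h => h.1, hτ⟩, hy⟩)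
  have hyX : Metric.infDist y X ≤ Metric.infDist y Y + Metric.hausdorffDist Y X :=
    Metric.infDist_le_infDist_add_hausdorffDist (by rwa [Metric.hausdorffEDist_comm])
  rw [Metric.hausdorffDist_comm] at hyX
  have hxX : Metric.infDist x X ≤ Metric.infDist y X + dist x y :=
    Metric.infDist_le_infDist_add_dist
  change Metric.infDist x X ≤ _
  linarith

end HausdorffStability

/-- approximation of the pointwise second derivative of the convexity defect
function from a Hausdorff-close set, `C^3` case (third-order Taylor bound). -/
theorem local_reach_approx_order_three {D : ℕ}
    (M Mt : Set (EuclideanSpace ℝ (Fin D)))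
    (hM : IsCompact M) (hMne : M.Nonempty) (hMt : IsCompact Mt) (hMtne : Mt.Nonempty)
    (ε Δ : ℝ) (hε : 0 < ε) (hεΔ : ε < Δ) (hΔ : Δ < 1)
    (hH : Metric.hausdorffDist M Mt < ε)
    (κ C' : ℝ) (hκ : 0 ≤ κ) (hC' : 0 ≤ C')
    (hTaylor : ∀ t ∈ Set.Icc (0 : ℝ) (Δ + ε), |cdf M t - κ / 2 * t ^ 2| ≤ C' * t ^ 3) :
    |κ - 2 * cdf Mt Δ / Δ ^ 2| ≤ 2 * C' * Δ + (3 * κ + 14 * C' + 4) * ε / Δ ^ 2 ∧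
      (Δ = ε ^ ((1 : ℝ) / 3) →
        |κ - 2 * cdf Mt Δ / Δ ^ 2| ≤ (3 * κ + 16 * C' + 4) * ε ^ ((1 : ℝ) / 3)) := by
  have hΔ0 : 0 < Δ := hε.trans hεΔ
  have hupper := cdf_le_cdf_add hMt.isBounded hMtne hM.isBounded hMne hε
    (by rwa [Metric.hausdorffDist_comm]) Δ
  have hlower := cdf_le_cdf_add hM.isBounded hMne hMt.isBounded hMtne hε hH (Δ - ε)
  rw [sub_add_cancel] at hlower
  have hTupper := (abs_le.1 (hTaylor (Δ + ε) ⟨by linarith, le_rfl⟩)).2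
  have hTlower := (abs_le.1 (hTaylor (Δ - ε) ⟨by linarith, by linarith⟩)).1
  have hεΔ_le : ε * Δ ≤ ε := by nlinarith
  have hεε_le : ε * ε ≤ ε := by nlinarith
  have hsq : (Δ + ε) ^ 2 ≤ Δ ^ 2 + 3 * ε := by nlinarith
  have hsq' : Δ ^ 2 - 3 * ε ≤ (Δ - ε) ^ 2 := by nlinarith
  have hcube : (Δ + ε) ^ 3 ≤ Δ ^ 3 + 7 * ε := by
    have h₁ : ε * Δ * Δ ≤ ε := by nlinarith
    have h₂ : ε * ε * Δ ≤ ε := by nlinarith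
    have h₃ : ε * ε * ε ≤ ε := by nlinarith
    nlinarith
  have hcube' : (Δ - ε) ^ 3 ≤ Δ ^ 3 + 7 * ε := by
    have : (Δ - ε) ^ 3 ≤ Δ ^ 3 := pow_le_pow_left₀ (by linarith) (by linarith) 3
    linarith
  have hmain : |κ - 2 * cdf Mt Δ / Δ ^ 2| ≤
      2 * C' * Δ + (3 * κ + 14 * C' + 4) * ε / Δ ^ 2 := by
    have hleft : κ - 2 * cdf Mt Δ / Δ ^ 2 = (κ * Δ ^ 2 - 2 * cdf Mt Δ) / Δ ^ 2 := by
      field_simp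
    have hright : 2 * C' * Δ + (3 * κ + 14 * C' + 4) * ε / Δ ^ 2 =
        (2 * C' * Δ ^ 3 + (3 * κ + 14 * C' + 4) * ε) / Δ ^ 2 := by
      field_simp
    rw [hleft, hright, abs_div, abs_of_pos (pow_pos hΔ0 2)]
    gcongr
    have h₁ := mul_le_mul_of_nonneg_left hsq hκ
    have h₂ := mul_le_mul_of_nonneg_left hsq' hκ
    have h₃ := mul_le_mul_of_nonneg_left hcube hC'
    have h₄ := mul_le_mul_of_nonneg_left hcube' hC'
    rw [abs_le]
    constructor <;> linarith
  refine ⟨hmain, fun h => ?_⟩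
  have hεcube : ε = Δ ^ 3 := by
    rw [h, ← Real.rpow_natCast, ← Real.rpow_mul hε.le]
    norm_num
  have hquot : (3 * κ + 14 * C' + 4) * ε / Δ ^ 2 = (3 * κ + 14 * C' + 4) * Δ := by
    rw [hεcube]
    field_simp
  rw [← h]
  rw [hquot] at hmain
  linarith
end
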